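/- For every integer m, the discriminant of the polynomial f_m(x) = x^6 - 2m x^5 - (5m+15) x^4 - 20 x^3 + 5m x^2 + (2m+6) x + 1 equals 6^6 · (m^2+3m+9)^5. -/

import Mathlib

open Polynomial Finset

/-- Up to sign, the product of the squared differences of a finite family is the product of the
values at its members of the derivative of the monic polynomial with these roots. -/
lemma prod_filter_lt_sub_sq_eq_prod_eval_derivative {ι R : Type*} [Fintype ι] [LinearOrder ι]
    [CommRing R] (r : ι → R) :
    (∏ p ∈ Finset.univ.filter (fun p : ι × ι => p.1 < p.2), (r p.1 - r p.2) ^ 2)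
      = (-1) ^ #(Finset.univ.filter (fun p : ι × ι => p.1 < p.2))
        * ∏ i, (derivative (∏ j, (X - C (r j)))).eval (r i) := by
  have eval_derivative (i : ι) : (derivative (∏ j, (X - C (r j)))).eval (r i)
      = ∏ j ∈ Finset.univ.filter (fun j => j ≠ i), (r i - r j) := by
    rw [← Finset.mul_prod_erase univ _ (mem_univ i)]
    simp [derivative_mul, eval_prod, Finset.filter_ne']
  have split (i : ι) : ∏ j ∈ Finset.univ.filter (fun j => j ≠ i), (r i - r j)
      = (∏ j, if i < j then r i - r j else 1) * ∏ j, if j < i then r i - r j else 1 := by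
    rw [Finset.prod_filter, ← Finset.prod_mul_distrib]
    refine Finset.prod_congr rfl fun j _ => ?_
    rcases lt_trichotomy i j with h | rfl | h
    · simp [h, h.ne', h.not_gt]
    · simp
    · simp [h, h.ne, h.not_gt]
  simp_rw [eval_derivative, split]
  rw [Finset.prod_mul_distrib, Finset.prod_comm (f := fun i j => if j < i then r i - r j else 1),
    ← Finset.prod_mul_distrib, ← Finset.prod_const, Finset.prod_filter, Finset.prod_filter,
    Fintype.prod_prod_type, Fintype.prod_prod_type, ← Finset.prod_mul_distrib]
  refine Finset.prod_congr rfl fun i _ => ?_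
  simp_rw [← Finset.prod_mul_distrib]
  refine Finset.prod_congr rfl fun j _ => ?_
  split_ifs <;> ring

/-- The discriminant of the simplest sextic polynomial
`f_m = x^6 - 2m x^5 - (5m+15) x^4 - 20 x^3 + 5m x^2 + (2m+6) x + 1`
equals `6^6 · (m^2+3m+9)^5`.  Since `f_m` is monic of degree 6, its discriminant
is the product of squared differences of its six roots (in ℂ). -/
theorem simplest_sextic_discriminant (m : ℤ) (r : Fin 6 → ℂ)
    (hf : (X ^ 6 - C (2 * (m : ℂ)) * X ^ 5 - C (5 * (m : ℂ) + 15) * X ^ 4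
        - C (20 : ℂ) * X ^ 3 + C (5 * (m : ℂ)) * X ^ 2 + C (2 * (m : ℂ) + 6) * X + 1)
      = ∏ i : Fin 6, (X - C (r i))) :
    (∏ p ∈ Finset.univ.filter (fun p : Fin 6 × Fin 6 => p.1 < p.2), (r p.1 - r p.2) ^ 2)
      = (6 : ℂ) ^ 6 * ((m : ℂ) ^ 2 + 3 * m + 9) ^ 5 := by
  have prod_sub (c : ℂ) : ∏ i, (r i - c) = c ^ 6 - 2 * m * c ^ 5 - (5 * m + 15) * c ^ 4
      - 20 * c ^ 3 + 5 * m * c ^ 2 + (2 * m + 6) * c + 1 := by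
    have h : ∏ i, (r i - c) = ∏ i, (c - r i) := by
      simp_rw [← neg_sub c, Finset.prod_neg]
      norm_num
    rw [h]
    simpa [eval_prod] using (congrArg (eval c) hf).symm
  have root (i : Fin 6) : r i ^ 6 - 2 * m * r i ^ 5 - (5 * m + 15) * r i ^ 4
      - 20 * r i ^ 3 + 5 * m * r i ^ 2 + (2 * m + 6) * r i + 1 = 0 := by
    rw [← prod_sub]
    exact Finset.prod_eq_zero (mem_univ i) (sub_self _)
  -- The Wronskian of the coefficients of `1` and `-m` in `f_m` is `2 (x^2 + x + 1)^5`.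
  have wronskian (i : Fin 6) : (derivative (∏ j, (X - C (r j)))).eval (r i)
      * ((r i - 0) * (r i - 1) * (r i - -1) * (2 * (r i - -1 / 2)) * (r i - -2))
      = 2 * (r i ^ 2 + r i + 1) ^ 5 := by
    rw [← hf]
    simp
    linear_combination (10 * r i ^ 4 + 20 * r i ^ 3 - 10 * r i - 2) * root i
  obtain ⟨ω, hω⟩ : ∃ ω : ℂ, ω ^ 2 + ω + 1 = 0 := by
    obtain ⟨ω, h⟩ := IsAlgClosed.exists_root (X ^ 2 + X + 1 : ℂ[X]) <| by
      have : (X ^ 2 + X + 1 : ℂ[X]).degree = 2 := by compute_degree!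
      simp [this]
    exact ⟨ω, by simpa using h⟩
  have norm : ∏ i, (r i ^ 2 + r i + 1) = 27 * ((m : ℂ) ^ 2 + 3 * m + 9) := by
    have factor (i : Fin 6) : r i ^ 2 + r i + 1 = (r i - ω) * (r i - (-1 - ω)) := by
      linear_combination hω
    have at_root (c : ℂ) (hc : c ^ 2 + c + 1 = 0) :
        ∏ i, (r i - c) = -18 - 3 * m - (6 * m + 9) * c := by
      rw [prod_sub]
      linear_combination (c ^ 4 - (2 * m + 1) * c ^ 3 - (3 * m + 15) * c ^ 2 + (5 * m - 4) * c
        + (3 * m + 19)) * hc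
    simp_rw [factor]
    rw [Finset.prod_mul_distrib, at_root ω hω,
      at_root (-1 - ω) (by linear_combination hω)]
    linear_combination (-(6 * m + 9) ^ 2 : ℂ) * hω
  have key := Finset.prod_congr (rfl : (univ : Finset (Fin 6)) = univ) fun i _ => wronskian i
  simp only [Finset.prod_mul_distrib, Finset.prod_pow, norm, prod_sub,
    Finset.prod_const, Finset.card_univ, Fintype.card_fin] at key
  have card : #(Finset.univ.filter (fun p : Fin 6 × Fin 6 => p.1 < p.2)) = 15 := by decide
  rw [prod_filter_lt_sub_sq_eq_prod_eval_derivative, card]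
  ring_nf at key ⊢
  linear_combination key / 19683
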